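/- arXiv:2106.02496 — 2 statements merged into one kernel-verified Lean document; each statement's English description precedes it below -/
import Mathlib

section
/- Let X be a type, K ≥ 1 and N ≥ 1 integers, h : Fin K → (X → ({−1, 1})) a family of classifiers and S = ((x_1, y_1), …, (x_N, y_N)) a labeled sample with x_i ∈ X and y_i ∈ {−1, 1}. Assume there exists k* ∈ Fin K with h_{k*}(x_i) = y_i for all i. For each i ∈ Fin N, let f(i) ∈ Fin K be the least index k such that h_k(x_j) = y_j for all j ≠ i (which exists since k* qualifies). Then the number of leave-one-out mistakes satisfies |{ i ∈ Fin N : h_{f(i)}(x_i) ≠ y_i }| ≤ K − 1; in particular the leave-one-out error (1/N)·Σ_{i=1}^N 1{h_{f(i)}(x_i) ≠ y_i} is at most K/N. -/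
theorem stmt_13 {X : Type*} (K N : ℕ) (hK : 1 ≤ K) (hN : 1 ≤ N)
    (h : Fin K → X → ℤ) (x : Fin N → X) (y : Fin N → ℤ)
    (hy : ∀ i, y i = 1 ∨ y i = -1)
    (kstar : Fin K) (hstar : ∀ i, h kstar (x i) = y i)
    (f : Fin N → Fin K)
    (hf : ∀ i : Fin N,
      (∀ j : Fin N, j ≠ i → h (f i) (x j) = y j) ∧
      ∀ k : Fin K, (∀ j : Fin N, j ≠ i → h k (x j) = y j) → f i ≤ k) :
    (Finset.univ.filter fun i : Fin N => h (f i) (x i) ≠ y i).card ≤ K - 1 ∧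
    (1 / (N : ℝ)) * ∑ i : Fin N, (if h (f i) (x i) ≠ y i then (1 : ℝ) else 0)
      ≤ (K : ℝ) / N := by
  have hcard : (Finset.univ.filter fun i : Fin N => h (f i) (x i) ≠ y i).card ≤ K - 1 := by
    calc
      _ ≤ (Finset.univ.erase kstar).card := by
        refine Finset.card_le_card_of_injOn f ?_ ?_
        · intro i hi
          simp only [Finset.coe_filter, Finset.mem_univ, true_and, Set.mem_ofPred_eq] at hi
          simp only [Finset.coe_erase, Finset.coe_univ, Set.mem_sdiff, Set.mem_univ, true_and,
            Set.mem_singleton_iff]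
          exact fun hik => hi (hik ▸ hstar i)
        · intro i hi j _ hij
          simp only [Finset.coe_filter, Finset.mem_univ, true_and, Set.mem_ofPred_eq] at hi
          by_contra hne
          exact hi (hij ▸ (hf j).1 i hne)
      _ = K - 1 := by simp
  refine ⟨hcard, ?_⟩
  rw [Finset.sum_boole, one_div, inv_mul_eq_div]
  gcongr
  exact hcard.trans (Nat.sub_le K 1)
end

section
/- Let X be a measurable space, Y = {−1, 1}, and D a probability measure on X × Y. Let K ≥ 1 and let h : Fin K → (X → Y) be measurable classifiers. Let N ≥ 1, and let A be the learning rule that maps a sample S to h_{f(S)}, where f(S) is the least k ∈ Fin K such that h_k is consistent with S (i.e., h_k(x) = y for every (x, y) in S), defaulting to index 1 if no such k exists; assume ((S, x) ↦ A(S)(x)) is measurable. Assume that for D^{N+1}-almost every sample S' of size N+1, some h_k is consistent with S'. Then the expected risk of the returned hypothesis satisfies E_{S ~ D^N}[R(A(S))] ≤ K/(N+1). -/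
open MeasureTheory
open scoped ENNReal

/-- The binary label space Y = {−1, 1} (as a subtype of ℤ). -/
def Label : Type := {y : ℤ // y = -1 ∨ y = 1}

instance : MeasurableSpace Label := Subtype.instMeasurableSpace

instance : DecidableEq Label := Subtype.instDecidableEq

instance : MeasurableSingletonClass Label := Subtype.instMeasurableSingletonClass

instance : Countable Label := Subtype.countable

/-- A quantity that bounds the number of leave-one-out events that occur at almost every sample of
size `N + 1` bounds `N + 1` times the probability of a single such event. -/
theorem lintegral_le_div_of_card_removeNth_le {Z : Type*} [MeasurableSpace Z]
    (D : Measure Z) [IsProbabilityMeasure D] (N K : ℕ)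
    {E : Set (Z × (Fin N → Z))} (hE : MeasurableSet E)
    (hcard : ∀ᵐ S ∂(Measure.pi fun _ : Fin (N + 1) => D),
      {i : Fin (N + 1) | (S i, (i.removeNth S : Fin N → Z)) ∈ E}.ncard ≤ K) :
    ∫⁻ S, D {z : Z | (z, S) ∈ E} ∂(Measure.pi fun _ : Fin N => D)
      ≤ (K : ℝ≥0∞) / ((N : ℝ≥0∞) + 1) := by
  classical
  have hmp (i : Fin (N + 1)) := measurePreserving_piFinSuccAbove (fun _ : Fin (N + 1) => D) i
  rw [ENNReal.le_div_iff_mul_le (by simp) (by simp)]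
  have hprod := Measure.prod_apply_symm (μ := D) (ν := Measure.pi fun _ : Fin N => D) hE
  simp only [Set.preimage] at hprod
  rw [← hprod]
  calc (D.prod (Measure.pi fun _ : Fin N => D)) E * ((N : ℝ≥0∞) + 1)
      = ∑ i : Fin (N + 1), ∫⁻ S, E.indicator 1 (S i, (i.removeNth S : Fin N → Z))
          ∂(Measure.pi fun _ : Fin (N + 1) => D) := by
        have (i : Fin (N + 1)) : ∫⁻ S, E.indicator 1 (S i, (i.removeNth S : Fin N → Z))
            ∂(Measure.pi fun _ : Fin (N + 1) => D)
            = (D.prod (Measure.pi fun _ : Fin N => D)) E := by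
          rw [← lintegral_indicator_one hE]
          exact (hmp i).lintegral_comp (measurable_one.indicator hE)
        simp [this, mul_comm]
    _ = ∫⁻ S, ∑ i : Fin (N + 1), E.indicator 1 (S i, (i.removeNth S : Fin N → Z))
          ∂(Measure.pi fun _ : Fin (N + 1) => D) :=
        (lintegral_finsetSum _ fun i _ =>
          (measurable_one.indicator hE).comp (hmp i).measurable).symm
    _ ≤ ∫⁻ _, (K : ℝ≥0∞) ∂(Measure.pi fun _ : Fin (N + 1) => D) := by
        refine lintegral_mono_ae ?_
        filter_upwards [hcard] with S hS
        rw [Set.ncard_eq_toFinset_card'] at hS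
        simpa [Set.indicator_apply] using hS
    _ = K := by simp

/-- If a consistent learning rule chooses among `K` classifiers, then at most `K` of the
leave-one-out hypotheses of a realizable sample err on the example left out. -/
theorem ncard_leave_one_out_errors_le {X Y : Type*} {K N : ℕ} {h : Fin K → X → Y}
    {f : (Fin N → X × Y) → Fin K}
    (hf : ∀ S : Fin N → X × Y, (∃ k : Fin K, ∀ j : Fin N, h k (S j).1 = (S j).2) →
      ∀ j : Fin N, h (f S) (S j).1 = (S j).2)
    {S : Fin (N + 1) → X × Y} (hS : ∃ k : Fin K, ∀ j, h k (S j).1 = (S j).2) :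
    {i : Fin (N + 1) | h (f (i.removeNth S)) (S i).1 ≠ (S i).2}.ncard ≤ K := by
  obtain ⟨k, hk⟩ := hS
  have hinj : Set.InjOn (fun i : Fin (N + 1) => f (i.removeNth S))
      {i : Fin (N + 1) | h (f (i.removeNth S)) (S i).1 ≠ (S i).2} := by
    intro i hi i' _ heq
    by_contra hne
    obtain ⟨j, rfl⟩ := Fin.exists_succAbove_eq hne
    apply hi
    simp only at heq
    rw [heq]
    exact hf (i'.removeNth S) ⟨k, fun j => hk _⟩ j
  rw [← hinj.ncard_image]
  simpa using Set.ncard_le_card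
    ((fun i : Fin (N + 1) => f (i.removeNth S)) ''
      {i : Fin (N + 1) | h (f (i.removeNth S)) (S i).1 ≠ (S i).2})

theorem stmt_15 {X : Type*} [MeasurableSpace X]
    (D : Measure (X × Label)) [IsProbabilityMeasure D]
    (K : ℕ) (hK : 1 ≤ K)
    (h : Fin K → X → Label) (hmeas : ∀ k, Measurable (h k))
    (N : ℕ) (hN : 1 ≤ N)
    (f : (Fin N → X × Label) → Fin K)
    -- f S is the least k such that h k is consistent with S ...
    (hf : ∀ S : Fin N → X × Label,
      (∃ k : Fin K, ∀ j : Fin N, h k (S j).1 = (S j).2) →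
        (∀ j : Fin N, h (f S) (S j).1 = (S j).2) ∧
        ∀ k : Fin K, (∀ j : Fin N, h k (S j).1 = (S j).2) → f S ≤ k)
    -- ... defaulting to the first index if no consistent classifier exists
    (hf' : ∀ S : Fin N → X × Label,
      (¬ ∃ k : Fin K, ∀ j : Fin N, h k (S j).1 = (S j).2) → f S = ⟨0, hK⟩)
    (A : (Fin N → X × Label) → X → Label)
    (hA : ∀ S, A S = h (f S))
    (hAmeas : Measurable fun p : (Fin N → X × Label) × X => A p.1 p.2)
    -- for D^{N+1}-almost every sample of size N+1, some classifier is consistent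
    (hcons : ∀ᵐ S' ∂(Measure.pi fun _ : Fin (N + 1) => D),
      ∃ k : Fin K, ∀ j : Fin (N + 1), h k (S' j).1 = (S' j).2) :
    ∫⁻ S, D {z : X × Label | A S z.1 ≠ z.2} ∂(Measure.pi fun _ : Fin N => D)
      ≤ (K : ℝ≥0∞) / ((N : ℝ≥0∞) + 1) := by
  have hE : MeasurableSet {p : (X × Label) × (Fin N → X × Label) | A p.2 p.1.1 ≠ p.1.2} :=
    (measurableSet_eq_fun
      (hAmeas.comp (measurable_snd.prodMk (measurable_fst.comp measurable_fst)))
      (measurable_snd.comp measurable_fst)).compl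
  refine lintegral_le_div_of_card_removeNth_le D N K hE ?_
  filter_upwards [hcons] with S hS
  simpa only [hA] using ncard_leave_one_out_errors_le (fun S hS => (hf S hS).1) hS
end
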